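/- For every fixed integer k >= 0 and every integer n >= 0, the equality a(n+1,k) = r(n+1,k) + 2 * (sum over i = 0,...,n of binomial(n,i) * (n-i)! * a(i,k)) holds. Equivalently, the exponential generating function A_k(x) = sum over n >= 0 of a(n,k) x^n / n! satisfies the differential equation A_k'(x) = 2 A_k(x)/(1-x) + R_k'(x) with initial condition A_k(0) = 0, where R_k(x) = sum over n >= 0 of r(n,k) x^n / n!. -/

import Mathlib

namespace BalancedTrees

/-- Plane binary trees with vertices labeled by natural numbers;
`nil` is the empty tree, and each child of a vertex is designated
as a left child or a right child. -/
inductive BT where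
  | nil : BT
  | node (label : ℕ) (l r : BT) : BT
deriving DecidableEq

namespace BT

/-- `balRank t = some k` if and only if the root of `t` is a balanced vertex of
rank `k`, i.e. every descending path from the root to a leaf has length `k`. -/
def balRank : BT → Option ℕ
  | .nil => none
  | .node _ .nil .nil => some 0
  | .node _ .nil (.node b rl rr) => (balRank (BT.node b rl rr)).map (· + 1)
  | .node _ (.node a ll lr) .nil => (balRank (BT.node a ll lr)).map (· + 1)
  | .node _ (.node a ll lr) (.node b rl rr) =>
      match balRank (BT.node a ll lr), balRank (BT.node b rl rr) with
      | some i, some j => if i = j then some (i + 1) else none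
      | _, _ => none

/-- The number of balanced vertices of rank `k` in the tree `t`. -/
def countBal (k : ℕ) : BT → ℕ
  | .nil => 0
  | .node v l r =>
      countBal k l + countBal k r +
        (if balRank (BT.node v l r) = some k then 1 else 0)

/-- The number of balanced vertices (of any rank) in the tree `t`. -/
def countBalAll : BT → ℕ
  | .nil => 0
  | .node v l r =>
      countBalAll l + countBalAll r +
        (if (balRank (BT.node v l r)).isSome then 1 else 0)

/-- Auxiliary, fuelled version of `treeOf`. -/
def treeOfAux : ℕ → List ℕ → BT
  | 0, _ => .nil
  | _ + 1, [] => .nil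
  | fuel + 1, l =>
      let m := l.foldr max 0
      BT.node m (treeOfAux fuel (l.takeWhile (· != m)))
                (treeOfAux fuel ((l.dropWhile (· != m)).tail))

/-- The decreasing binary tree `T(π)` of a sequence `π` of distinct labels:
the root is the maximum entry, and its left (resp. right) subtree is built
recursively from the part of the sequence to the left (resp. right) of the
maximum. This is a bijection between permutations of `{1,…,n}` and
decreasing binary trees on `{1,…,n}`. -/
def treeOf (l : List ℕ) : BT := treeOfAux l.length l

/-- Canonical form for non-plane 1-2 trees (as represented by plane trees):
an only child is stored as a left child, and of two (unordered) children the
one with the larger label is stored on the left. Decreasing binary trees in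
canonical form are in bijection with non-plane 1-2 trees. -/
def canonNP : BT → Bool
  | .nil => true
  | .node _ l r =>
      canonNP l && canonNP r &&
        (match l, r with
         | .nil, .nil => true
         | .node _ _ _, .nil => true
         | .nil, .node _ _ _ => false
         | .node a _ _, .node b _ _ => decide (b < a))

/-- Canonical form for plane 1-2 trees: an only child is stored as a left
child (an only child carries no left/right designation), while two children
remain ordered. Decreasing binary trees in canonical form are in bijection
with plane 1-2 trees. -/
def canonP : BT → Bool
  | .nil => true
  | .node _ l r =>
      canonP l && canonP r &&
        (match l, r with
         | .nil, .node _ _ _ => false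
         | _, _ => true)

end BT

open BT

/-- The list of all permutations of `{1,…,n}`, each written as a list. -/
def perms (n : ℕ) : List (List ℕ) := (List.range' 1 n).permutations

/-- `a n k`: the total number of balanced vertices of rank `k` over all
decreasing binary trees on `{1,…,n}`. -/
def a (n k : ℕ) : ℕ := ((perms n).map fun l => countBal k (treeOf l)).sum

/-- `r n k`: the number of decreasing binary trees on `{1,…,n}` whose root is
balanced of rank `k`. -/
def r (n k : ℕ) : ℕ :=
  ((perms n).filter fun l => decide (balRank (treeOf l) = some k)).length

/-- `p n k`: the probability that the root of a uniformly random decreasing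
binary tree on `{1,…,n}` is balanced of rank `k`; by convention `p 0 k = 1`. -/
def p (n k : ℕ) : ℚ := if n = 0 then 1 else (r n k : ℚ) / (Nat.factorial n : ℚ)

/-- The number of decreasing binary trees on `{1,…,n}` whose root is balanced. -/
def rootBal (n : ℕ) : ℕ :=
  ((perms n).filter fun l => (balRank (treeOf l)).isSome).length

/-- `proot n`: the probability that the root of a uniformly random decreasing
binary tree on `{1,…,n}` is balanced. -/
def proot (n : ℕ) : ℚ := (rootBal n : ℚ) / (Nat.factorial n : ℚ)

/-- The total number of balanced vertices over all decreasing binary trees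
on `{1,…,n}`. -/
def totalBal (n : ℕ) : ℕ := ((perms n).map fun l => countBalAll (treeOf l)).sum

/-- `Pbal n`: the probability that a vertex chosen uniformly at random from
the `n * n!` vertices of all decreasing binary trees on `{1,…,n}` is balanced. -/
def Pbal (n : ℕ) : ℚ := (totalBal n : ℚ) / ((n : ℚ) * (Nat.factorial n : ℚ))

/-- Permutations whose decreasing binary tree is a canonical representative
of a non-plane 1-2 tree; these are in bijection with non-plane 1-2 trees
on `{1,…,n}`. -/
def npPerms (n : ℕ) : List (List ℕ) := (perms n).filter fun l => canonNP (treeOf l)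

/-- `E n`: the number of non-plane 1-2 trees on `{1,…,n}` (the Euler number). -/
def E (n : ℕ) : ℕ := (npPerms n).length

/-- `b n k`: the total number of balanced vertices of rank `k` over all
non-plane 1-2 trees on `{1,…,n}`. -/
def b (n k : ℕ) : ℕ := ((npPerms n).map fun l => countBal k (treeOf l)).sum

/-- `s n k`: the number of non-plane 1-2 trees on `{1,…,n}` whose root is
balanced of rank `k`. -/
def s (n k : ℕ) : ℕ :=
  ((npPerms n).filter fun l => decide (balRank (treeOf l) = some k)).length

/-- Permutations whose decreasing binary tree is a canonical representative
of a plane 1-2 tree; these are in bijection with plane 1-2 trees on `{1,…,n}`. -/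
def pPerms (n : ℕ) : List (List ℕ) := (perms n).filter fun l => canonP (treeOf l)

/-- `z n`: the number of plane 1-2 trees on `{1,…,n}`. -/
def z (n : ℕ) : ℕ := (pPerms n).length

/-- `d n k`: the total number of balanced vertices of rank `k` over all
plane 1-2 trees on `{1,…,n}`. -/
def d (n k : ℕ) : ℕ := ((pPerms n).map fun l => countBal k (treeOf l)).sum

/-- `t n k`: the number of plane 1-2 trees on `{1,…,n}` whose root is
balanced of rank `k`. -/
def t (n k : ℕ) : ℕ :=
  ((pPerms n).filter fun l => decide (balRank (treeOf l) = some k)).length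

end BalancedTrees

namespace BalancedTrees

namespace BT

/-- Apply a function to all labels of a tree. -/
def mapLabels (g : ℕ → ℕ) : BT → BT
  | .nil => .nil
  | .node v l r => .node (g v) (mapLabels g l) (mapLabels g r)

theorem balRank_mapLabels (g : ℕ → ℕ) (t : BT) : balRank (mapLabels g t) = balRank t := by
  induction t with
  | nil => rfl
  | node v l r ihl ihr =>
    cases l <;> cases r <;> simp_all [mapLabels, balRank]

theorem countBal_mapLabels (k : ℕ) (g : ℕ → ℕ) (t : BT) :
    countBal k (mapLabels g t) = countBal k t := by
  induction t with
  | nil => rfl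
  | node v l r ihl ihr =>
    have h := balRank_mapLabels g (.node v l r)
    simp only [mapLabels] at h
    simp only [mapLabels, countBal, ihl, ihr, h]

end BT

open BT

theorem foldr_max_map {g : ℕ → ℕ} (l : List ℕ) (hl : l ≠ [])
    (hg : MonotoneOn g {x | x ∈ l}) :
    (l.map g).foldr max 0 = g (l.foldr max 0) ∧ l.foldr max 0 ∈ l := by
  induction l with
  | nil => exact absurd rfl hl
  | cons x l ih =>
    rcases eq_or_ne l [] with rfl | h
    · simp
    · obtain ⟨h1, h2⟩ := ih h (hg.mono fun y hy => List.mem_cons_of_mem _ hy)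
      have hx : x ∈ {y | y ∈ x :: l} := List.mem_cons_self
      have hm : l.foldr max 0 ∈ {y | y ∈ x :: l} := List.mem_cons_of_mem _ h2
      simp only [List.map_cons, List.foldr_cons, h1]
      refine ⟨(hg.map_max hx hm).symm, ?_⟩
      rcases max_choice x (l.foldr max 0) with h | h <;> rw [h]
      · exact hx
      · exact hm

theorem takeWhile_bne_map {g : ℕ → ℕ} {m : ℕ} (l : List ℕ)
    (h : ∀ x ∈ l, g x = g m ↔ x = m) :
    (l.map g).takeWhile (· != g m) = (l.takeWhile (· != m)).map g ∧
      (l.map g).dropWhile (· != g m) = (l.dropWhile (· != m)).map g := by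
  induction l with
  | nil => simp
  | cons x l ih =>
    obtain ⟨h1, h2⟩ := ih fun y hy => h y (List.mem_cons_of_mem _ hy)
    have hx := h x List.mem_cons_self
    by_cases hxm : x = m
    · simp [hxm]
    · have : g x ≠ g m := fun e => hxm (hx.1 e)
      simp [hxm, this, h1, h2]

theorem treeOfAux_map {g : ℕ → ℕ} (fuel : ℕ) (l : List ℕ) (hg : StrictMonoOn g {x | x ∈ l}) :
    treeOfAux fuel (l.map g) = mapLabels g (treeOfAux fuel l) := by
  induction fuel generalizing l with
  | zero => rfl
  | succ fuel ih =>
    cases l with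
    | nil => rfl
    | cons x l =>
      obtain ⟨h1, h2⟩ := foldr_max_map (x :: l) (by simp) hg.monotoneOn
      obtain ⟨h3, h4⟩ := takeWhile_bne_map (g := g) (m := (x :: l).foldr max 0) (x :: l)
        fun y hy => hg.injOn.eq_iff hy h2
      rw [List.map_cons] at h1 h3 h4 ⊢
      simp only [treeOfAux, mapLabels]
      rw [h1, h3, h4, ← List.map_tail, ih, ih]
      · exact hg.mono fun y hy => (List.dropWhile_suffix _).subset (List.mem_of_mem_tail hy)
      · exact hg.mono fun y hy => (List.takeWhile_prefix _).subset hy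

theorem treeOfAux_eq_treeOf (fuel : ℕ) (l : List ℕ) (h : l.length ≤ fuel) :
    treeOfAux fuel l = treeOf l := by
  induction fuel using Nat.strong_induction_on generalizing l with
  | _ fuel ih =>
    unfold treeOf
    cases l with
    | nil => cases fuel <;> rfl
    | cons x l =>
      obtain ⟨fuel, rfl⟩ : ∃ f, fuel = f + 1 :=
        Nat.exists_eq_succ_of_ne_zero (by simp at h; omega)
      obtain ⟨-, hm⟩ := foldr_max_map (g := id) (x :: l) (by simp) (monotone_id.monotoneOn _)
      simp only [List.length_cons, treeOfAux]
      simp only [List.length_cons, add_le_add_iff_right] at h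
      generalize (x :: l).foldr max 0 = m at hm
      have hlen := congrArg List.length
        (List.takeWhile_append_dropWhile (p := (· != m)) (l := x :: l))
      have hne : (x :: l).dropWhile (· != m) ≠ [] := by
        rw [Ne, List.dropWhile_eq_nil_iff]
        exact fun hall => by simpa using hall m hm
      have hpos := List.length_pos_iff.2 hne
      simp only [List.length_append, List.length_cons] at hlen
      have e1 : ((x :: l).takeWhile (· != m)).length ≤ l.length := by omega
      have e2 : ((x :: l).dropWhile (· != m)).tail.length ≤ l.length := by
        rw [List.length_tail]; omega
      rcases h.eq_or_lt with rfl | hlt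
      · rfl
      · rw [ih fuel (by omega) _ (e1.trans h), ih fuel (by omega) _ (e2.trans h),
          ih l.length (by omega) _ e1, ih l.length (by omega) _ e2]

theorem foldr_max_append_cons {l₁ l₂ : List ℕ} {m : ℕ}
    (h₁ : ∀ x ∈ l₁, x < m) (h₂ : ∀ x ∈ l₂, x < m) : (l₁ ++ m :: l₂).foldr max 0 = m := by
  apply le_antisymm
  · apply List.max_le_of_forall_le
    intro x hx
    simp only [List.mem_append, List.mem_cons] at hx
    rcases hx with hx | rfl | hx
    · exact (h₁ x hx).le
    · exact le_rfl
    · exact (h₂ x hx).le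
  · exact List.le_max_of_le (a := m) (by simp) le_rfl

theorem treeOf_append_cons {l₁ l₂ : List ℕ} {m : ℕ}
    (h₁ : ∀ x ∈ l₁, x < m) (h₂ : ∀ x ∈ l₂, x < m) :
    treeOf (l₁ ++ m :: l₂) = .node m (treeOf l₁) (treeOf l₂) := by
  have hmax := foldr_max_append_cons h₁ h₂
  have hp : ∀ x ∈ l₁, (x != m) = true := fun x hx => by simpa using (h₁ x hx).ne
  have hlen : (l₁ ++ m :: l₂).length = (l₁.length + l₂.length) + 1 := by simp; omega
  rw [treeOf, hlen]
  have step : ∀ l : List ℕ, l ≠ [] → ∀ fuel, treeOfAux (fuel + 1) l =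
      .node (l.foldr max 0) (treeOfAux fuel (l.takeWhile (· != l.foldr max 0)))
        (treeOfAux fuel ((l.dropWhile (· != l.foldr max 0)).tail)) := by
    intro l hl fuel
    cases l with
    | nil => exact absurd rfl hl
    | cons => rfl
  rw [step _ (by simp), hmax, List.takeWhile_append_of_pos hp, List.dropWhile_append_of_pos hp]
  simp only [List.takeWhile_cons, List.dropWhile_cons, bne_self_eq_false, Bool.false_eq_true,
    if_false, List.append_nil, List.tail_cons]
  rw [treeOfAux_eq_treeOf _ _ (by omega), treeOfAux_eq_treeOf _ _ (by omega)]

theorem countBal_treeOf_map (k : ℕ) {g : ℕ → ℕ} (l : List ℕ) (hg : StrictMonoOn g {x | x ∈ l}) :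
    countBal k (treeOf (l.map g)) = countBal k (treeOf l) := by
  rw [treeOf, treeOfAux_map _ _ hg, countBal_mapLabels, List.length_map, treeOf]

/-- The total of `countBal k` does not depend on the set of labels. -/
theorem sum_countBal_permutations (k : ℕ) (l : List ℕ) (hl : l.Nodup) :
    (l.permutations.map fun π => countBal k (treeOf π)).sum = a l.length k := by
  have hperm : l.mergeSort.Perm l := List.mergeSort_perm _ _
  have hsort : l.mergeSort.SortedLT :=
    (List.pairwise_mergeSort' (· ≤ ·) l).sortedLE.sortedLT_of_nodup (hperm.nodup_iff.2 hl)
  have hlen := hperm.length_eq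
  rw [(hperm.symm.permutations.map _).sum_eq]
  generalize l.mergeSort = s at hsort hlen
  have hs : s = (List.range' 1 l.length).map fun i => s.getD (i - 1) 0 := by
    apply List.ext_getElem
    · simp [hlen]
    · intro i h₁ h₂
      simp [h₁]
  rw [a, perms]
  conv_lhs => rw [hs, ← List.map_permutations, List.map_map]
  refine congrArg List.sum (List.map_congr_left fun π hπ => ?_)
  refine countBal_treeOf_map k π fun x hx y hy hxy => ?_
  have hx' := List.mem_range'_1.1 ((List.mem_permutations.1 hπ).mem_iff.1 hx)
  have hy' := List.mem_range'_1.1 ((List.mem_permutations.1 hπ).mem_iff.1 hy)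
  show s.getD (x - 1) 0 < s.getD (y - 1) 0
  rw [List.getD_eq_getElem _ _ (by omega), List.getD_eq_getElem _ _ (by omega)]
  exact hsort.getElem_lt_getElem_of_lt (by omega)

theorem permutations_perm_flatMap_append_singleton {l : List ℕ} (hl : l.Nodup) (hne : l ≠ []) :
    l.permutations.Perm (l.flatMap fun x => (l.erase x).permutations.map (· ++ [x])) := by
  rw [List.perm_ext_iff_of_nodup (List.nodup_permutations _ hl)]
  · intro π
    simp only [List.mem_permutations, List.mem_flatMap, List.mem_map]
    constructor
    · intro h
      have hπ : π ≠ [] := fun e => hne (List.nil_perm.1 (e ▸ h))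
      have e := List.dropLast_append_getLast hπ
      refine ⟨π.getLast hπ, h.mem_iff.1 (List.getLast_mem hπ), π.dropLast, ?_, e⟩
      have h' : (π.getLast hπ :: π.dropLast).Perm l :=
        (List.perm_append_singleton _ _).symm.trans (by rwa [e])
      simpa using h'.erase (π.getLast hπ)
    · rintro ⟨x, hx, σ, hσ, rfl⟩
      exact (List.perm_append_singleton _ _).trans
        ((hσ.cons x).trans (List.perm_cons_erase hx).symm)
  · rw [List.nodup_flatMap]
    refine ⟨fun x _ => ?_, ?_⟩
    · exact (List.nodup_permutations _ (hl.erase x)).map (List.append_left_injective _)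
    · refine hl.imp fun {x y} hxy => ?_
      intro π h₁ h₂
      simp only [List.mem_map] at h₁ h₂
      obtain ⟨σ, -, rfl⟩ := h₁
      obtain ⟨τ, -, h⟩ := h₂
      exact hxy (by simpa using (List.append_inj' h rfl).2.symm)

theorem sum_countBal_take (k i j : ℕ) (l : List ℕ) (hl : l.Nodup) (hlen : l.length = i + j) :
    (l.permutations.map fun π => countBal k (treeOf (π.take i))).sum =
      (i + j).choose i * j.factorial * a i k := by
  induction j generalizing l with
  | zero =>
    rw [add_zero] at hlen
    subst hlen
    rw [← sum_countBal_permutations k l hl]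
    simp only [add_zero, Nat.choose_self, Nat.factorial_zero, one_mul]
    refine congrArg List.sum (List.map_congr_left fun π hπ => ?_)
    rw [List.take_of_length_le (List.mem_permutations.1 hπ).length_eq.le]
  | succ j ih =>
    have hne : l ≠ [] := by rintro rfl; simp at hlen
    rw [((permutations_perm_flatMap_append_singleton hl hne).map _).sum_eq, List.map_flatMap,
      List.flatMap_def, List.sum_flatten, List.map_map]
    have hterm : ∀ x ∈ l, (((l.erase x).permutations.map (· ++ [x])).map
        fun π => countBal k (treeOf (π.take i))).sum =
          (i + j).choose i * j.factorial * a i k := by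
      intro x hx
      have hx' : (l.erase x).length = i + j := by
        rw [List.length_erase_of_mem hx, hlen]; rfl
      rw [← ih _ (hl.erase x) hx', List.map_map]
      refine congrArg List.sum (List.map_congr_left fun π hπ => ?_)
      have := (List.mem_permutations.1 hπ).length_eq
      simp only [Function.comp_apply]
      rw [List.take_append_of_le_length (by omega)]
    refine (congrArg List.sum (List.map_congr_left hterm)).trans ?_
    rw [List.map_const', List.sum_replicate, hlen, smul_eq_mul]
    have h := Nat.choose_mul_succ_eq (i + j) i
    rw [show i + j + 1 - i = j + 1 by omega] at h
    rw [Nat.factorial_succ, ← add_assoc]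
    calc (i + j + 1) * ((i + j).choose i * j.factorial * a i k)
        = ((i + j).choose i * (i + j + 1)) * (j.factorial * a i k) := by ring
      _ = _ := by rw [h]; ring

theorem map_rotate_permutations_perm {l : List ℕ} (hl : l.Nodup) (i : ℕ) :
    (l.permutations.map (·.rotate i)).Perm l.permutations := by
  have hnd := List.nodup_permutations _ hl
  rw [List.perm_ext_iff_of_nodup (hnd.map (List.rotate_injective i)) hnd]
  intro π
  simp only [List.mem_map, List.mem_permutations]
  constructor
  · rintro ⟨σ, hσ, rfl⟩
    exact (List.rotate_perm σ i).trans hσ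
  · intro h
    exact ⟨_, (List.rotate_perm _ _).trans h, List.rotate_eq_iff.2 rfl⟩

theorem sum_countBal_drop (k i j : ℕ) (l : List ℕ) (hl : l.Nodup) (hlen : l.length = i + j) :
    (l.permutations.map fun π => countBal k (treeOf (π.drop j))).sum =
      (i + j).choose i * j.factorial * a i k := by
  rw [← sum_countBal_take k i j l hl hlen]
  refine Eq.trans ?_ ((map_rotate_permutations_perm hl j).map _).sum_eq
  rw [List.map_map]
  refine congrArg List.sum (List.map_congr_left fun π hπ => ?_)
  have := (List.mem_permutations.1 hπ).length_eq
  simp only [Function.comp_apply]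
  rw [List.rotate_eq_drop_append_take (by omega), List.take_left' (by simp; omega)]

theorem permutations'Aux_eq_map {α : Type*} (x : α) (l : List α) :
    l.permutations'Aux x =
      (List.range (l.length + 1)).map fun i => l.take i ++ x :: l.drop i := by
  induction l with
  | nil => rfl
  | cons y l ih =>
    rw [List.permutations'Aux, ih, List.length_cons, List.range_succ_eq_map (n := l.length + 1)]
    simp [Function.comp_def]

theorem perms_succ_perm (n : ℕ) :
    (perms (n + 1)).Perm ((perms n).flatMap fun π =>
      (List.range (n + 1)).map fun i => π.take i ++ (n + 1) :: π.drop i) := by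
  have h : (List.range' 1 (n + 1)).Perm ((n + 1) :: List.range' 1 n) := by
    rw [List.range'_1_concat, add_comm 1 n]
    exact List.perm_append_singleton _ _
  refine (h.permutations.trans (List.permutations_perm_permutations' _)).trans ?_
  rw [List.permutations']
  refine ((List.permutations_perm_permutations' _).symm.flatMap_right _).trans ?_
  refine List.Perm.of_eq (List.flatMap_congr fun π hπ => ?_)
  rw [permutations'Aux_eq_map, (List.mem_permutations.1 hπ).length_eq, List.length_range']

theorem sum_map_add_ite {α : Type*} (L : List α) (f : α → ℕ) (q : α → Prop) [DecidablePred q] :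
    (L.map fun x => f x + if q x then 1 else 0).sum =
      (L.filter fun x => decide (q x)).length + (L.map f).sum := by
  induction L with
  | nil => rfl
  | cons x L ih =>
    rw [List.map_cons, List.sum_cons, ih, List.map_cons, List.sum_cons, List.filter_cons]
    by_cases h : q x <;> simp [h] <;> omega

theorem sum_map_sum_range {α : Type*} (L : List α) (n : ℕ) (f : α → ℕ → ℕ) :
    (L.map fun x => ((List.range n).map (f x)).sum).sum =
      ∑ i ∈ Finset.range n, (L.map fun x => f x i).sum := by
  induction L with
  | nil => simp
  | cons x L ih =>
    simp only [List.map_cons, List.sum_cons, ih, Finset.sum_add_distrib]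
    rfl

theorem a_succ_eq (n k : ℕ) :
    a (n + 1) k = r (n + 1) k + ∑ i ∈ Finset.range (n + 1),
      ((perms n).map fun π =>
        countBal k (treeOf (π.take i)) + countBal k (treeOf (π.drop i))).sum := by
  have hp := perms_succ_perm n
  rw [a, r, (hp.map _).sum_eq, (hp.filter _).length_eq, ← sum_map_sum_range]
  generalize hL : ((perms n).flatMap fun π =>
      (List.range (n + 1)).map fun i => π.take i ++ (n + 1) :: π.drop i) = L
  have hroot : ∀ t : BT, ∀ v l r, t = .node v l r → countBal k t =
      (countBal k l + countBal k r) + if balRank t = some k then 1 else 0 := by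
    rintro _ v l r rfl; rfl
  let F : List ℕ → ℕ := fun l =>
    countBal k (treeOf l) - if balRank (treeOf l) = some k then 1 else 0
  have hF : ∀ π ∈ perms n, ∀ i,
      countBal k (treeOf (π.take i ++ (n + 1) :: π.drop i)) =
        (countBal k (treeOf (π.take i)) + countBal k (treeOf (π.drop i))) +
        if balRank (treeOf (π.take i ++ (n + 1) :: π.drop i)) = some k then 1 else 0 := by
    intro π hπ i
    have hlt : ∀ x ∈ π, x < n + 1 := fun x hx => by
      have := List.mem_range'_1.1 ((List.mem_permutations.1 hπ).mem_iff.1 hx)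
      omega
    exact hroot _ _ _ _ (treeOf_append_cons (fun x hx => hlt x (List.mem_of_mem_take hx))
      fun x hx => hlt x (List.mem_of_mem_drop hx))
  have hcount : ∀ l ∈ L, countBal k (treeOf l) =
      F l + if balRank (treeOf l) = some k then 1 else 0 := by
    subst hL
    intro l hl
    simp only [List.mem_flatMap, List.mem_map] at hl
    obtain ⟨π, hπ, i, -, rfl⟩ := hl
    have := hF π hπ i
    simp only [F]
    omega
  rw [List.map_congr_left hcount, sum_map_add_ite]
  congr 1
  subst hL
  rw [List.map_flatMap, List.flatMap_def, List.sum_flatten, List.map_map]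
  refine congrArg List.sum (List.map_congr_left fun π hπ => ?_)
  rw [Function.comp_apply, List.map_map]
  refine congrArg List.sum (List.map_congr_left fun i _ => ?_)
  have := hF π hπ i
  simp only [F, Function.comp_apply]
  omega

end BalancedTrees

open BalancedTrees

/-- For every fixed `k ≥ 0` and every `n ≥ 0`,
`a(n+1,k) = r(n+1,k) + 2 * ∑_{i=0}^{n} C(n,i) * (n-i)! * a(i,k)`,
which is the coefficientwise form of the differential equation
`A_k'(x) = 2 A_k(x)/(1-x) + R_k'(x)` with `A_k(0) = 0` for the exponential
generating functions of `a(·,k)` and `r(·,k)`. -/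
theorem statement0 (k n : ℕ) :
    a (n + 1) k =
      r (n + 1) k +
        2 * ∑ i ∈ Finset.range (n + 1),
          n.choose i * Nat.factorial (n - i) * a i k := by
  rw [a_succ_eq, two_mul]
  congr 1
  have hnd : (List.range' 1 n).Nodup := List.nodup_range'
  simp only [List.sum_map_add, Finset.sum_add_distrib, perms]
  congr 1
  · refine Finset.sum_congr rfl fun i hi => ?_
    have hi := Finset.mem_range.1 hi
    rw [sum_countBal_take k i (n - i) _ hnd (by simp; omega), show i + (n - i) = n by omega]
  · rw [← Finset.sum_range_reflect]
    refine Finset.sum_congr rfl fun i hi => ?_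
    have hi := Finset.mem_range.1 hi
    rw [show n + 1 - 1 - i = n - i by omega,
      sum_countBal_drop k i (n - i) _ hnd (by simp; omega), show i + (n - i) = n by omega]
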